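/- arXiv:2203.14164 — 3 statements merged into one kernel-verified Lean document; each statement's English description precedes it below -/
import Mathlib

section
/- Let M be a finitely generated torsion Λ-module. Then there exist non-negative integers μ and λ and an index N such that for every n ≥ N the kernel of the natural surjection M/ω_nM → M/ω_{n−1}M is a finite p-group, and ord_p(|ker(M/ω_nM → M/ω_{n−1}M)|) + dim_{ℚ_p}((M/ω_{n−1}M) ⊗_{ℤ_p} ℚ_p) = μ·φ(p^n) + λ. (This is the statement that the Kobayashi rank ∇M_{Γ_n} is defined for n ≫ 0 and equals φ(p^n)·μ(M) + λ(M), where μ(M) and λ(M) are the Iwasawa invariants of M.) -/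
open scoped TensorProduct

/-- `Φ_n ∈ Λ = ℤ_p⟦T⟧`: the `p^n`-th cyclotomic polynomial evaluated at `1 + T`. -/
noncomputable def PhiLT (p : ℕ) [Fact p.Prime] (n : ℕ) : PowerSeries ℤ_[p] :=
  (((Polynomial.cyclotomic (p ^ n) ℤ_[p]).comp (Polynomial.X + 1) : Polynomial ℤ_[p]) :
    PowerSeries ℤ_[p])

/-- `ω_n = (1 + T)^{p^n} - 1 ∈ Λ = ℤ_p⟦T⟧`. -/
noncomputable def omegaLT (p : ℕ) [Fact p.Prime] (n : ℕ) : PowerSeries ℤ_[p] :=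
  (1 + PowerSeries.X) ^ (p ^ n) - 1

section
variable (p : ℕ) [Fact p.Prime]

theorem PhiLT_succ_eq_geom_sum (n : ℕ) :
    PhiLT p (n + 1) = ∑ i ∈ Finset.range p, ((1 + PowerSeries.X) ^ p ^ n) ^ i := by
  rw [PhiLT, Polynomial.cyclotomic_prime_pow_eq_geom_sum Fact.out, ← Polynomial.coe_compRingHom_apply,
    ← Polynomial.coeToPowerSeries.ringHom_apply]
  simp [add_comm]

theorem PhiLT_succ_mul_omegaLT (n : ℕ) :
    PhiLT p (n + 1) * omegaLT p n = omegaLT p (n + 1) := by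
  rw [PhiLT_succ_eq_geom_sum, omegaLT, geom_sum_mul, omegaLT, ← pow_mul, pow_succ]

theorem omegaLT_dvd_PhiLT_succ_sub (n : ℕ) :
    omegaLT p n ∣ PhiLT p (n + 1) - (p : PowerSeries ℤ_[p]) := by
  have h : PhiLT p (n + 1) - (p : PowerSeries ℤ_[p]) =
      ∑ i ∈ Finset.range p, (((1 + PowerSeries.X) ^ p ^ n) ^ i - 1 ^ i) := by
    simp [PhiLT_succ_eq_geom_sum]
  rw [h]
  exact Finset.dvd_sum fun i _ => sub_dvd_pow_sub_pow _ 1 i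

theorem omegaLT_mem_pow (n : ℕ) :
    omegaLT p n ∈ (Ideal.span {(p : PowerSeries ℤ_[p]), PowerSeries.X}) ^ (n + 1) := by
  induction n with
  | zero =>
    rw [zero_add, pow_one]
    simpa [omegaLT] using Ideal.subset_span (by simp)
  | succ n ih =>
    rw [← PhiLT_succ_mul_omegaLT, pow_succ' _ (n + 1)]
    refine Ideal.mul_mem_mul ?_ ih
    rw [← sub_add_cancel (PhiLT p (n + 1)) (p : PowerSeries ℤ_[p])]
    refine add_mem (Ideal.mem_of_dvd _ (omegaLT_dvd_PhiLT_succ_sub p n)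
      (Ideal.pow_le_self n.succ_ne_zero ih)) (Ideal.subset_span (by simp))

theorem PowerSeries.natCast_zmod_eq_zero : (p : PowerSeries (ZMod p)) = 0 := by
  rw [← map_natCast (PowerSeries.C (R := ZMod p)), CharP.cast_eq_zero, map_zero]

theorem PowerSeries.natCast_dvd_iff_map_toZMod (f : PowerSeries ℤ_[p]) :
    (p : PowerSeries ℤ_[p]) ∣ f ↔ PowerSeries.map PadicInt.toZMod f = 0 := by
  have key (x : ℤ_[p]) : PadicInt.toZMod x = 0 ↔ (p : ℤ_[p]) ∣ x := by
    rw [← RingHom.mem_ker, PadicInt.ker_toZMod, PadicInt.maximalIdeal_eq_span_p,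
      Ideal.mem_span_singleton]
  constructor
  · rintro ⟨g, rfl⟩
    simp [PowerSeries.natCast_zmod_eq_zero]
  · intro h
    have h' (n : ℕ) : (p : ℤ_[p]) ∣ PowerSeries.coeff n f := by
      rw [← key, ← PowerSeries.coeff_map, h, map_zero]
    choose g hg using h'
    refine ⟨PowerSeries.mk g, ?_⟩
    ext n
    rw [← map_natCast (PowerSeries.C (R := ℤ_[p])), PowerSeries.coeff_C_mul, PowerSeries.coeff_mk,
      hg]

theorem PhiLT_sub_X_pow_dvd {n : ℕ} (hn : 0 < n) :
    (p : PowerSeries ℤ_[p]) ∣ PhiLT p n - PowerSeries.X ^ (p ^ n).totient := by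
  have h := Polynomial.cyclotomic_mul_prime_pow_eq (ZMod p) (p := p) (m := 1)
    (Nat.Prime.not_dvd_one Fact.out) hn
  rw [mul_one, Polynomial.cyclotomic_one] at h
  rw [PowerSeries.natCast_dvd_iff_map_toZMod, map_sub, sub_eq_zero, PhiLT,
    ← Polynomial.polynomial_map_coe, Polynomial.map_comp, Polynomial.map_cyclotomic, h,
    Nat.totient_prime_pow Fact.out hn]
  simp [Nat.mul_sub, ← pow_succ, Nat.sub_add_cancel hn]

theorem PowerSeries.natCard_quotient_span_natCast_X_pow (k : ℕ) :
    Nat.card (PowerSeries ℤ_[p] ⧸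
      Ideal.span {(p : PowerSeries ℤ_[p]), PowerSeries.X ^ k}) = p ^ k := by
  let e : PowerSeries ℤ_[p] →+ (Fin k → ZMod p) :=
    { toFun := fun f i => PadicInt.toZMod (PowerSeries.coeff i f)
      map_zero' := by ext; simp
      map_add' := fun f g => by ext; simp }
  have he : Function.Surjective e := fun v => by
    choose u hu using fun i => ZMod.ringHom_surjective (PadicInt.toZMod (p := p)) (v i)
    refine ⟨PowerSeries.mk fun i => if h : i < k then u ⟨i, h⟩ else 0, ?_⟩
    ext i
    simp [e, hu]
  have hker : e.ker = (Ideal.span {(p : PowerSeries ℤ_[p]), PowerSeries.X ^ k}).toAddSubgroup := by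
    ext f
    have h₁ : f ∈ e.ker ↔ PowerSeries.X ^ k ∣ PowerSeries.map PadicInt.toZMod f := by
      rw [PowerSeries.X_pow_dvd_iff, AddMonoidHom.mem_ker, funext_iff]
      exact ⟨fun h i hi => by
        rw [PowerSeries.coeff_map]; exact h ⟨i, hi⟩, fun h i => by
        have := h i i.2; rwa [PowerSeries.coeff_map] at this⟩
    rw [h₁, Submodule.mem_toAddSubgroup, Ideal.mem_span_pair]
    constructor
    · rintro ⟨g, hg⟩
      obtain ⟨g, rfl⟩ := PowerSeries.map_surjective _
        (ZMod.ringHom_surjective (PadicInt.toZMod (p := p))) g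
      obtain ⟨h, hh⟩ := (PowerSeries.natCast_dvd_iff_map_toZMod p (f - PowerSeries.X ^ k * g)).2
        (by simp [hg])
      exact ⟨h, g, by linear_combination -hh⟩
    · rintro ⟨a, b, rfl⟩
      simp [PowerSeries.natCast_zmod_eq_zero]
  have := Nat.card_congr (QuotientAddGroup.quotientKerEquivOfSurjective e he).toEquiv
  rw [hker, Nat.card_fun, Nat.card_zmod, Nat.card_fin] at this
  exact this
end

theorem LinearMap.natCard_eq_card_ker_mul_card_range {R A B : Type*} [CommRing R] [AddCommGroup A]
    [AddCommGroup B] [Module R A] [Module R B] (f : A →ₗ[R] B) :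
    Nat.card A = Nat.card (LinearMap.ker f) * Nat.card (LinearMap.range f) := by
  rw [← Nat.card_congr f.quotKerEquivRange.toEquiv, mul_comm]
  exact AddSubgroup.card_eq_card_quotient_mul_card_addSubgroup (LinearMap.ker f).toAddSubgroup

theorem Function.Exact.natCard_eq {R A B C : Type*} [CommRing R] [AddCommGroup A]
    [AddCommGroup B] [AddCommGroup C] [Module R A] [Module R B] [Module R C] {f : A →ₗ[R] B}
    {g : B →ₗ[R] C} (h : Function.Exact f g) :
    Nat.card B = Nat.card (LinearMap.range f) * Nat.card (LinearMap.range g) := by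
  rw [g.natCard_eq_card_ker_mul_card_range, h.linearMap_ker_eq]

section
variable {R : Type*} [CommRing R] {N₁ N₂ N₃ : Type*} [AddCommGroup N₁] [AddCommGroup N₂]
  [AddCommGroup N₃] [Module R N₁] [Module R N₂] [Module R N₃]

theorem natCard_ker_coker_of_exact {f : N₁ →ₗ[R] N₂} {g : N₂ →ₗ[R] N₃}
    (hf : Function.Injective f) (hg : Function.Surjective g) (hfg : Function.Exact f g)
    {i₁ : N₁ →ₗ[R] N₁} {i₂ : N₂ →ₗ[R] N₂} {i₃ : N₃ →ₗ[R] N₃}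
    (h₁ : f.comp i₁ = i₂.comp f) (h₂ : g.comp i₂ = i₃.comp g) :
    Nat.card (LinearMap.ker i₂) ∣ Nat.card (LinearMap.ker i₁) * Nat.card (LinearMap.ker i₃) ∧
    Nat.card (LinearMap.ker i₁) * Nat.card (LinearMap.ker i₃) *
        Nat.card (N₂ ⧸ LinearMap.range i₂) =
      Nat.card (LinearMap.ker i₂) *
        (Nat.card (N₁ ⧸ LinearMap.range i₁) * Nat.card (N₃ ⧸ LinearMap.range i₃)) := by
  have h₁' (x : N₁) : f (i₁ x) = i₂ (f x) := LinearMap.congr_fun h₁ x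
  have h₂' (x : N₂) : g (i₂ x) = i₃ (g x) := LinearMap.congr_fun h₂ x
  have k₁ : ∀ x ∈ LinearMap.ker i₁, f x ∈ LinearMap.ker i₂ := fun x hx => by
    rw [LinearMap.mem_ker, ← h₁', LinearMap.mem_ker.1 hx, map_zero]
  have k₂ : ∀ x ∈ LinearMap.ker i₂, g x ∈ LinearMap.ker i₃ := fun x hx => by
    rw [LinearMap.mem_ker, ← h₂', LinearMap.mem_ker.1 hx, map_zero]
  let F₁ := f.restrict k₁
  let F₂ := g.restrict k₂
  have c₁ : LinearMap.range i₁ ≤ (LinearMap.range i₂).comap f := by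
    rintro _ ⟨x, rfl⟩
    exact ⟨f x, (h₁' x).symm⟩
  have c₂ : LinearMap.range i₂ ≤ (LinearMap.range i₃).comap g := by
    rintro _ ⟨x, rfl⟩
    exact ⟨g x, (h₂' x).symm⟩
  let G₁ := Submodule.mapQ _ _ f c₁
  let G₂ := Submodule.mapQ _ _ g c₂
  have hπ₁ : Function.Exact i₁ (LinearMap.range i₁).mkQ := i₁.exact_map_mkQ_range
  have hπ₂ : Function.Exact i₂ (LinearMap.range i₂).mkQ := i₂.exact_map_mkQ_range
  let δ := SnakeLemma.δ' i₁ i₂ i₃ f g hfg f g hfg h₁ h₂ (LinearMap.ker i₃).subtype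
    i₃.exact_subtype_ker_map (LinearMap.range i₁).mkQ hπ₁ hg hf
  have e₂ : Function.Exact F₂ δ := SnakeLemma.exact_δ'_right i₁ i₂ i₃ f g hfg f g hfg h₁ h₂
    (LinearMap.ker i₂).subtype i₂.exact_subtype_ker_map (LinearMap.ker i₃).subtype
    i₃.exact_subtype_ker_map (LinearMap.range i₁).mkQ hπ₁ hg hf F₂ rfl
    (Submodule.subtype_injective _)
  have e₃ : Function.Exact δ G₁ := SnakeLemma.exact_δ'_left i₁ i₂ i₃ f g hfg f g hfg h₁ h₂
    (LinearMap.ker i₃).subtype i₃.exact_subtype_ker_map (LinearMap.range i₁).mkQ hπ₁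
    (LinearMap.range i₂).mkQ hπ₂ hg hf G₁ rfl (Submodule.mkQ_surjective _)
  have e₁ : Function.Exact F₁ F₂ := by
    rintro ⟨x, hx⟩
    constructor
    · intro h
      obtain ⟨y, rfl⟩ := (hfg x).1 (congrArg Subtype.val h)
      refine ⟨⟨y, hf ?_⟩, rfl⟩
      rw [h₁', map_zero]
      exact hx
    · rintro ⟨y, hy⟩
      exact Subtype.ext ((hfg x).2 ⟨y, congrArg Subtype.val hy⟩)
  have e₄ : Function.Exact G₁ G₂ := by
    intro x
    obtain ⟨x, rfl⟩ := Submodule.mkQ_surjective _ x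
    constructor
    · intro h
      obtain ⟨z, hz⟩ := (Submodule.Quotient.mk_eq_zero _).1 h
      obtain ⟨z, rfl⟩ := hg z
      obtain ⟨y, hy⟩ := (hfg (x - i₂ z)).1 (by
        rw [map_sub, ← hz, sub_eq_zero]; exact (h₂' z).symm)
      refine ⟨(LinearMap.range i₁).mkQ y, ?_⟩
      refine (Submodule.Quotient.eq _).2 ⟨-z, ?_⟩
      rw [hy, map_neg]; abel
    · rintro ⟨y, hy⟩
      obtain ⟨y, rfl⟩ := Submodule.mkQ_surjective _ y
      rw [← hy]
      change Submodule.Quotient.mk (g (f y)) = _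
      rw [hfg.apply_apply_eq_zero, Submodule.Quotient.mk_zero]
  have hF₁ : Function.Injective F₁ := fun x y h =>
    Subtype.ext (hf (congrArg Subtype.val h))
  have hG₂ : Function.Surjective G₂ := fun x => by
    obtain ⟨x, rfl⟩ := Submodule.mkQ_surjective _ x
    obtain ⟨y, rfl⟩ := hg x
    exact ⟨(LinearMap.range i₂).mkQ y, rfl⟩
  rw [Nat.card_congr (LinearEquiv.ofInjective F₁ hF₁).toEquiv, e₁.natCard_eq, e₂.natCard_eq,
    e₃.natCard_eq, e₄.natCard_eq, LinearMap.range_eq_top.2 hG₂,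
    Nat.card_congr (Submodule.topEquiv (R := R)
      (M := N₃ ⧸ LinearMap.range i₃)).toEquiv]
  exact ⟨⟨Nat.card (LinearMap.range δ), by ring⟩, by ring⟩
end

section

open PowerSeries

theorem Submodule.natCard_quotient_dvd_of_le {R M : Type*} [CommRing R] [AddCommGroup M] [Module R M]
    {A B : Submodule R M} (h : A ≤ B) : Nat.card (M ⧸ B) ∣ Nat.card (M ⧸ A) :=
  AddSubgroup.card_dvd_of_surjective (Submodule.factor h).toAddMonoidHom
    (Submodule.factor_surjective h)

theorem Ideal.natCard_quotient_quotient_range_lsmul {R : Type*} [CommRing R] (I : Ideal R) (a : R) :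
    Nat.card ((R ⧸ I) ⧸ LinearMap.range (LinearMap.lsmul R (R ⧸ I) a)) =
      Nat.card (R ⧸ (I ⊔ Ideal.span {a})) := by
  let q : R →ₗ[R] (R ⧸ I) ⧸ LinearMap.range (LinearMap.lsmul R (R ⧸ I) a) :=
    (LinearMap.range (LinearMap.lsmul R (R ⧸ I) a)).mkQ.comp (Submodule.mkQ I)
  have hq : Function.Surjective q :=
    (Submodule.mkQ_surjective _).comp (Submodule.mkQ_surjective _)
  have hker : LinearMap.ker q = I ⊔ Ideal.span {a} := by
    ext x
    rw [LinearMap.mem_ker, Submodule.mem_sup]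
    refine (Submodule.Quotient.mk_eq_zero _).trans ?_
    constructor
    · rintro ⟨y, hy⟩
      obtain ⟨y, rfl⟩ := Submodule.mkQ_surjective _ y
      refine ⟨x - a * y, ?_, a * y, Ideal.mem_span_singleton.2 ⟨y, rfl⟩, sub_add_cancel _ _⟩
      exact (Submodule.Quotient.eq I).1 hy.symm
    · rintro ⟨y, hy, z, hz, rfl⟩
      obtain ⟨z, rfl⟩ := Ideal.mem_span_singleton.1 hz
      refine ⟨Submodule.mkQ I z, ?_⟩
      refine (Submodule.Quotient.eq I).2 ?_
      simpa using I.neg_mem hy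
  rw [← hker]
  exact Nat.card_congr (q.quotKerEquivOfSurjective hq).toEquiv.symm

theorem Ideal.natCard_quotient_quotient_ker_lsmul {R : Type*} [CommRing R] (I : Ideal R) [I.IsPrime]
    {a : R} (ha : a ∉ I) : Nat.card (LinearMap.ker (LinearMap.lsmul R (R ⧸ I) a)) = 1 := by
  have : LinearMap.ker (LinearMap.lsmul R (R ⧸ I) a) = ⊥ := by
    rw [Submodule.eq_bot_iff]
    intro x hx
    obtain ⟨x, rfl⟩ := Submodule.mkQ_surjective _ x
    have h : a * x ∈ I := (Submodule.Quotient.mk_eq_zero I).1 hx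
    exact (Submodule.Quotient.mk_eq_zero I).2
      ((Ideal.IsPrime.mem_or_mem inferInstance h).resolve_left ha)
  rw [this, Nat.card_unique]

section
variable (p : ℕ) [Fact p.Prime]

/-- For `n ≫ 0`, the multiplication by `Φ_n` on `M` has kernel and cokernel finite `p`-groups, and
the quotient of their orders is `p ^ (μ φ(p^n) + λ)`. -/
def HasIwasawaGrowth (M : Type*) [AddCommGroup M] [Module ℤ_[p]⟦X⟧ M] : Prop :=
  ∃ μ lam N : ℕ, ∀ n, N ≤ n → ∃ j,
    Nat.card (LinearMap.ker (LinearMap.lsmul ℤ_[p]⟦X⟧ M (PhiLT p n))) = p ^ j ∧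
    Nat.card (M ⧸ LinearMap.range (LinearMap.lsmul ℤ_[p]⟦X⟧ M (PhiLT p n))) =
      p ^ (j + (μ * (p ^ n).totient + lam))

variable {p}

theorem HasIwasawaGrowth.of_natCard_eq {M : Type*} [AddCommGroup M] [Module ℤ_[p]⟦X⟧ M]
    {c : ℕ} (h : Nat.card M = p ^ c) : HasIwasawaGrowth p M := by
  have hp : p.Prime := Fact.out
  refine ⟨0, 0, 0, fun n _ => ?_⟩
  set f := LinearMap.lsmul ℤ_[p]⟦X⟧ M (PhiLT p n)
  have h₁ := f.natCard_eq_card_ker_mul_card_range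
  have h₂ : Nat.card M = Nat.card (M ⧸ LinearMap.range f) * Nat.card (LinearMap.range f) :=
    AddSubgroup.card_eq_card_quotient_mul_card_addSubgroup (LinearMap.range f).toAddSubgroup
  obtain ⟨j, -, hj⟩ := (Nat.dvd_prime_pow hp).1 (h ▸ Dvd.intro _ h₁.symm)
  refine ⟨j, hj, ?_⟩
  have h₀ : Nat.card (LinearMap.range f) ≠ 0 := by
    intro h₀
    rw [h₀, mul_zero, h] at h₁
    exact pow_ne_zero _ hp.ne_zero h₁
  simpa [← hj] using mul_right_cancel₀ h₀ (h₂.symm.trans h₁)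

theorem HasIwasawaGrowth.of_exact {N₁ N₂ N₃ : Type*} [AddCommGroup N₁] [AddCommGroup N₂]
    [AddCommGroup N₃] [Module ℤ_[p]⟦X⟧ N₁] [Module ℤ_[p]⟦X⟧ N₂] [Module ℤ_[p]⟦X⟧ N₃]
    {f : N₁ →ₗ[ℤ_[p]⟦X⟧] N₂} {g : N₂ →ₗ[ℤ_[p]⟦X⟧] N₃}
    (hf : Function.Injective f) (hg : Function.Surjective g) (hfg : Function.Exact f g)
    (h₁ : HasIwasawaGrowth p N₁) (h₃ : HasIwasawaGrowth p N₃) : HasIwasawaGrowth p N₂ := by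
  have hp : p.Prime := Fact.out
  obtain ⟨μ₁, l₁, n₁, h₁⟩ := h₁
  obtain ⟨μ₃, l₃, n₃, h₃⟩ := h₃
  refine ⟨μ₁ + μ₃, l₁ + l₃, max n₁ n₃, fun n hn => ?_⟩
  obtain ⟨j₁, hk₁, hc₁⟩ := h₁ n (le_of_max_le_left hn)
  obtain ⟨j₃, hk₃, hc₃⟩ := h₃ n (le_of_max_le_right hn)
  obtain ⟨hdvd, hcard⟩ := natCard_ker_coker_of_exact hf hg hfg
    (i₁ := LinearMap.lsmul _ _ (PhiLT p n)) (i₂ := LinearMap.lsmul _ _ (PhiLT p n))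
    (i₃ := LinearMap.lsmul _ _ (PhiLT p n)) (by ext; simp) (by ext; simp)
  rw [hk₁, hk₃, ← pow_add] at hdvd hcard
  obtain ⟨j, -, hj⟩ := (Nat.dvd_prime_pow hp).1 hdvd
  refine ⟨j, hj, mul_left_cancel₀ (pow_ne_zero (j₁ + j₃) hp.ne_zero) ?_⟩
  rw [hcard, hj, hc₁, hc₃]
  ring

theorem exists_X_pow_mem_of_notMem {P : Ideal ℤ_[p]⟦X⟧} {g : ℤ_[p]⟦X⟧} (hg : g ∈ P)
    (hgp : ¬ (p : ℤ_[p]⟦X⟧) ∣ g) : ∃ d, (X : ℤ_[p]⟦X⟧) ^ d ∈ P ⊔ Ideal.span {(p : ℤ_[p]⟦X⟧)} := by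
  rw [PowerSeries.natCast_dvd_iff_map_toZMod] at hgp
  obtain ⟨d, u, hu⟩ := IsDiscreteValuationRing.associated_pow_irreducible hgp
    PowerSeries.X_irreducible
  obtain ⟨v, hv⟩ := PowerSeries.map_surjective _
    (ZMod.ringHom_surjective (PadicInt.toZMod (p := p))) (u : (ZMod p)⟦X⟧)
  refine ⟨d, Submodule.mem_sup.2 ⟨g * v, P.mul_mem_right v hg, X ^ d - g * v,
    Ideal.mem_span_singleton.2 ?_, by ring⟩⟩
  rw [PowerSeries.natCast_dvd_iff_map_toZMod]
  simp [hv, hu]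

theorem span_pow_le_sup_span_sq {P : Ideal ℤ_[p]⟦X⟧} {d : ℕ}
    (hd : (X : ℤ_[p]⟦X⟧) ^ d ∈ P ⊔ Ideal.span {(p : ℤ_[p]⟦X⟧)}) :
    Ideal.span {(p : ℤ_[p]⟦X⟧), X} ^ ((1 + d) * 3) ≤ P ⊔ Ideal.span {(p : ℤ_[p]⟦X⟧) ^ 2} := by
  have h₁ : Ideal.span {(p : ℤ_[p]⟦X⟧), X} ^ (1 + d) ≤ P ⊔ Ideal.span {(p : ℤ_[p]⟦X⟧)} := by
    rw [Ideal.span_insert]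
    refine Ideal.sup_pow_add_le_pow_sup_pow.trans (sup_le ?_ ?_)
    · rw [pow_one]; exact le_sup_right
    · rw [Ideal.span_singleton_pow, Ideal.span_singleton_le_iff_mem]
      exact hd
  rw [pow_mul]
  refine (Ideal.pow_right_mono h₁ 3).trans ?_
  refine (Ideal.sup_pow_add_le_pow_sup_pow (n := 1) (m := 2)).trans ?_
  rw [pow_one, Ideal.span_singleton_pow]

theorem exists_isUnit_PhiLT_sub_mem {P : Ideal ℤ_[p]⟦X⟧} {d n : ℕ}
    (hd : (X : ℤ_[p]⟦X⟧) ^ d ∈ P ⊔ Ideal.span {(p : ℤ_[p]⟦X⟧)}) (hn : (1 + d) * 3 < n) :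
    ∃ u : ℤ_[p]⟦X⟧, IsUnit u ∧ PhiLT p n - p * u ∈ P := by
  obtain ⟨n, rfl⟩ := Nat.exists_eq_succ_of_ne_zero (Nat.ne_of_gt (Nat.zero_lt_of_lt hn))
  have h : PhiLT p (n + 1) - (p : ℤ_[p]⟦X⟧) ∈ P ⊔ Ideal.span {(p : ℤ_[p]⟦X⟧) ^ 2} :=
    span_pow_le_sup_span_sq hd (Ideal.pow_le_pow_right (by lia)
      (Ideal.mem_of_dvd _ (omegaLT_dvd_PhiLT_succ_sub p n) (omegaLT_mem_pow p n)))
  obtain ⟨y, hy, z, hz, hyz⟩ := Submodule.mem_sup.1 h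
  obtain ⟨a, rfl⟩ := Ideal.mem_span_singleton.1 hz
  refine ⟨1 + p * a, ?_, ?_⟩
  · rw [PowerSeries.isUnit_iff_constantCoeff]
    have : (p : ℤ_[p]) * -(constantCoeff a) ∈ nonunits ℤ_[p] := by
      rw [← IsLocalRing.mem_maximalIdeal, PadicInt.maximalIdeal_eq_span_p]
      exact Ideal.mul_mem_right _ _ (Ideal.mem_span_singleton_self _)
    simpa using IsLocalRing.isUnit_one_sub_self_of_mem_nonunits _ this
  · convert hy using 1
    linear_combination -hyz

theorem exists_natCard_quotient_sup_span {P : Ideal ℤ_[p]⟦X⟧} {d : ℕ}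
    (hd : (X : ℤ_[p]⟦X⟧) ^ d ∈ P ⊔ Ideal.span {(p : ℤ_[p]⟦X⟧)}) :
    ∃ c, Nat.card (ℤ_[p]⟦X⟧ ⧸ (P ⊔ Ideal.span {(p : ℤ_[p]⟦X⟧)})) = p ^ c := by
  have hle : Ideal.span {(p : ℤ_[p]⟦X⟧), X ^ d} ≤ P ⊔ Ideal.span {(p : ℤ_[p]⟦X⟧)} := by
    rw [Ideal.span_le, Set.insert_subset_iff, Set.singleton_subset_iff]
    exact ⟨Ideal.mem_sup_right (Ideal.mem_span_singleton_self _), hd⟩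
  have h := Submodule.natCard_quotient_dvd_of_le hle
  rw [PowerSeries.natCard_quotient_span_natCast_X_pow] at h
  obtain ⟨c, -, hc⟩ := (Nat.dvd_prime_pow Fact.out).1 h
  exact ⟨c, hc⟩

theorem not_isUnit_natCast_powerSeries : ¬ IsUnit (p : ℤ_[p]⟦X⟧) := by
  rw [PowerSeries.isUnit_iff_constantCoeff, map_natCast]
  exact PadicInt.p_nonunit

theorem HasIwasawaGrowth.quotient_span_natCast (hP : (Ideal.span {(p : ℤ_[p]⟦X⟧)}).IsPrime) :
    HasIwasawaGrowth p (ℤ_[p]⟦X⟧ ⧸ Ideal.span {(p : ℤ_[p]⟦X⟧)}) := by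
  refine ⟨1, 0, 1, fun n hn => ⟨0, ?_, ?_⟩⟩
  · refine Ideal.natCard_quotient_quotient_ker_lsmul _ fun h => ?_
    have h₁ := (dvd_sub_right (Ideal.mem_span_singleton.1 h)).1 (PhiLT_sub_X_pow_dvd p hn)
    rw [PowerSeries.natCast_dvd_iff_map_toZMod] at h₁
    simp [PowerSeries.X_ne_zero] at h₁
  · obtain ⟨a, ha⟩ := PhiLT_sub_X_pow_dvd p hn
    have : Ideal.span {(p : ℤ_[p]⟦X⟧)} ⊔ Ideal.span {PhiLT p n} =
        Ideal.span {(p : ℤ_[p]⟦X⟧), X ^ (p ^ n).totient} := by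
      rw [← Ideal.span_insert, ← sub_add_cancel (PhiLT p n) (X ^ (p ^ n).totient), ha, add_comm,
        mul_comm, Ideal.span_pair_add_mul_left]
    rw [Ideal.natCard_quotient_quotient_range_lsmul, this,
      PowerSeries.natCard_quotient_span_natCast_X_pow]
    simp

theorem HasIwasawaGrowth.quotient_prime {P : Ideal ℤ_[p]⟦X⟧} [hP : P.IsPrime] (hP₀ : P ≠ ⊥) :
    HasIwasawaGrowth p (ℤ_[p]⟦X⟧ ⧸ P) := by
  by_cases hle : P ≤ Ideal.span {(p : ℤ_[p]⟦X⟧)}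
  · obtain ⟨f, hf, hf₀⟩ := Submodule.exists_mem_ne_zero_of_ne_bot hP₀
    obtain ⟨g, hg, hgp⟩ := (FiniteMultiplicity.of_not_isUnit
      (not_isUnit_natCast_powerSeries (p := p)) hf₀).exists_eq_pow_mul_and_not_dvd
    rw [hg] at hf
    have hpP : (p : ℤ_[p]⟦X⟧) ∈ P := by
      refine hP.mem_of_pow_mem _ ((hP.mem_or_mem hf).resolve_right fun h => hgp ?_)
      exact Ideal.mem_span_singleton.1 (hle h)
    obtain rfl := le_antisymm hle ((Ideal.span_singleton_le_iff_mem _).2 hpP)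
    exact .quotient_span_natCast hP
  · obtain ⟨g, hg, hgp⟩ := SetLike.not_le_iff_exists.1 hle
    obtain ⟨d, hd⟩ := exists_X_pow_mem_of_notMem hg (mt Ideal.mem_span_singleton.2 hgp)
    obtain ⟨c, hc⟩ := exists_natCard_quotient_sup_span hd
    by_cases hpP : (p : ℤ_[p]⟦X⟧) ∈ P
    · rw [sup_eq_left.2 ((Ideal.span_singleton_le_iff_mem _).2 hpP)] at hc
      exact .of_natCard_eq hc
    · refine ⟨0, c, (1 + d) * 3 + 1, fun n hn => ⟨0, ?_, ?_⟩⟩ <;>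
        obtain ⟨u, hu, hmem⟩ := exists_isUnit_PhiLT_sub_mem hd (n := n) hn
      · refine Ideal.natCard_quotient_quotient_ker_lsmul _ fun h => hpP ?_
        have := (Submodule.sub_mem_iff_right _ h).1 hmem
        exact (Ideal.mul_unit_mem_iff_mem P hu).1 this
      · have : P ⊔ Ideal.span {PhiLT p n} = P ⊔ Ideal.span {(p : ℤ_[p]⟦X⟧)} := by
          rw [← Ideal.span_singleton_mul_right_unit hu (p : ℤ_[p]⟦X⟧)]
          have h₁ : PhiLT p n - p * u ∈ P ⊔ Ideal.span {PhiLT p n} := Ideal.mem_sup_left hmem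
          have h₂ : PhiLT p n - p * u ∈ P ⊔ Ideal.span {p * u} := Ideal.mem_sup_left hmem
          refine le_antisymm (sup_le le_sup_left ?_) (sup_le le_sup_left ?_) <;>
            rw [Ideal.span_singleton_le_iff_mem]
          · exact (Submodule.sub_mem_iff_left _
              (Ideal.mem_sup_right (Ideal.mem_span_singleton_self _))).1 h₂
          · exact (Submodule.sub_mem_iff_right _
              (Ideal.mem_sup_right (Ideal.mem_span_singleton_self _))).1 h₁
        rw [Ideal.natCard_quotient_quotient_range_lsmul, this, hc]
        simp

theorem HasIwasawaGrowth.of_isTorsion {M : Type*} [AddCommGroup M] [Module ℤ_[p]⟦X⟧ M]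
    [hM : Module.Finite ℤ_[p]⟦X⟧ M] (htors : Module.IsTorsion ℤ_[p]⟦X⟧ M) :
    HasIwasawaGrowth p M := by
  revert htors
  induction hM using IsNoetherianRing.induction_on_isQuotientEquivQuotientPrime ℤ_[p]⟦X⟧ with
  | subsingleton N => exact fun _ => .of_natCard_eq (c := 0) (by simp)
  | quotient N P e =>
    intro htors
    have hP₀ : P.1 ≠ ⊥ := by
      intro h
      obtain ⟨a, ha⟩ := @htors (e.symm (Submodule.Quotient.mk 1))
      have h₁ : (Submodule.Quotient.mk ((a : ℤ_[p]⟦X⟧) • 1) : ℤ_[p]⟦X⟧ ⧸ P.1) = 0 := by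
        have := congrArg e ha
        rwa [Submonoid.smul_def, map_smul, e.apply_symm_apply, map_zero] at this
      rw [Submodule.Quotient.mk_eq_zero, h, smul_eq_mul, mul_one] at h₁
      exact nonZeroDivisors.coe_ne_zero a h₁
    refine .of_exact (f := e.symm.toLinearMap) (g := (0 : N →ₗ[ℤ_[p]⟦X⟧] PUnit)) e.symm.injective
      (Function.surjective_to_subsingleton _)
      ((e.symm.toLinearMap.exact_zero_iff_surjective _).2 e.symm.surjective)
      (.quotient_prime hP₀) (.of_natCard_eq (c := 0) (by simp))
  | exact N₁ N₂ N₃ f g hf hg hfg h₁ h₃ =>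
    intro htors
    refine .of_exact hf hg hfg (h₁ fun x => ?_) (h₃ fun x => ?_)
    · obtain ⟨a, ha⟩ := @htors (f x)
      exact ⟨a, hf (by simpa [Submonoid.smul_def] using ha)⟩
    · obtain ⟨x, rfl⟩ := hg x
      obtain ⟨a, ha⟩ := @htors x
      exact ⟨a, by simpa [Submonoid.smul_def] using congrArg g ha⟩
end

theorem LinearMap.finrank_baseChange_eq_of_natCard_ker {p : ℕ} [Fact p.Prime] {A B : Type*}
    [AddCommGroup A] [AddCommGroup B] [Module ℤ_[p] A] [Module ℤ_[p] B] (f : A →ₗ[ℤ_[p]] B)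
    (hf : Function.Surjective f) {k : ℕ} (hk : Nat.card (LinearMap.ker f) = p ^ k) :
    Module.finrank ℚ_[p] (ℚ_[p] ⊗[ℤ_[p]] A) = Module.finrank ℚ_[p] (ℚ_[p] ⊗[ℤ_[p]] B) := by
  have hp : (p : ℚ_[p]) ≠ 0 := by exact_mod_cast (Fact.out : p.Prime).ne_zero
  have hexact : Function.Exact ((LinearMap.ker f).subtype.lTensor ℚ_[p]) (f.lTensor ℚ_[p]) :=
    lTensor_exact _ f.exact_subtype_ker_map hf
  have hzero (z : ℚ_[p] ⊗[ℤ_[p]] LinearMap.ker f) : z = 0 := by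
    induction z with
    | zero => rfl
    | add x y hx hy => rw [hx, hy, add_zero]
    | tmul q x =>
      have hq : q = ((p : ℤ_[p]) ^ k) • (q / (p : ℚ_[p]) ^ k) := by
        rw [Algebra.smul_def, map_pow, map_natCast, mul_div_cancel₀ _ (pow_ne_zero _ hp)]
      have hx : ((p : ℤ_[p]) ^ k) • x = 0 := by
        rw [← Nat.cast_pow, Nat.cast_smul_eq_nsmul, ← hk]
        exact card_nsmul_eq_zero'
      rw [hq, TensorProduct.smul_tmul, hx, TensorProduct.tmul_zero]
  refine (LinearEquiv.ofBijective (f.baseChange ℚ_[p]) ⟨?_, ?_⟩).finrank_eq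
  · refine (injective_iff_map_eq_zero _).2 fun x hx => ?_
    obtain ⟨z, rfl⟩ := (hexact x).1 hx
    rw [hzero z, map_zero]
  · exact f.lTensor_surjective ℚ_[p] hf

section
variable {p : ℕ} [Fact p.Prime] {M : Type*} [AddCommGroup M] [Module ℤ_[p]⟦X⟧ M]

theorem mem_span_omegaLT_smul_top {n : ℕ} {x : M} :
    x ∈ (Ideal.span {omegaLT p n} • ⊤ : Submodule ℤ_[p]⟦X⟧ M) ↔ ∃ y, omegaLT p n • y = x := by
  rw [Submodule.ideal_span_singleton_smul, Submodule.mem_smul_pointwise_iff_exists]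
  simp

theorem omegaLT_succ_smul (n : ℕ) (x : M) :
    omegaLT p (n + 1) • x = omegaLT p n • PhiLT p (n + 1) • x := by
  rw [← mul_smul, mul_comm, PhiLT_succ_mul_omegaLT]

/-- The kernel of `M/ω_{n+1}M → M/ω_nM` has the same cardinality as the cokernel of `Φ_{n+1}` on the
quotient of `M` by its `ω_n`-torsion. -/
theorem natCard_ker_eq_natCard_quotient_range {n : ℕ} {K : Submodule ℤ_[p]⟦X⟧ M}
    (hK : LinearMap.ker (LinearMap.lsmul ℤ_[p]⟦X⟧ M (omegaLT p n)) = K)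
    (π : (M ⧸ (Ideal.span {omegaLT p (n + 1)} • ⊤ : Submodule ℤ_[p]⟦X⟧ M)) →ₗ[ℤ_[p]⟦X⟧]
      (M ⧸ (Ideal.span {omegaLT p n} • ⊤ : Submodule ℤ_[p]⟦X⟧ M)))
    (hπ : ∀ x : M, π (Submodule.Quotient.mk x) = Submodule.Quotient.mk x) :
    Nat.card (LinearMap.ker π) = Nat.card ((M ⧸ K) ⧸
      LinearMap.range (LinearMap.lsmul ℤ_[p]⟦X⟧ (M ⧸ K) (PhiLT p (n + 1)))) := by
  have hK' (x : M) : x ∈ K ↔ omegaLT p n • x = 0 := by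
    rw [← hK, LinearMap.mem_ker, LinearMap.lsmul_apply]
  let ψ : M →ₗ[ℤ_[p]⟦X⟧] M ⧸ (Ideal.span {omegaLT p (n + 1)} • ⊤ : Submodule ℤ_[p]⟦X⟧ M) :=
    (Submodule.mkQ _).comp (LinearMap.lsmul ℤ_[p]⟦X⟧ M (omegaLT p n))
  let χ : M →ₗ[ℤ_[p]⟦X⟧] (M ⧸ K) ⧸
      LinearMap.range (LinearMap.lsmul ℤ_[p]⟦X⟧ (M ⧸ K) (PhiLT p (n + 1))) :=
    (Submodule.mkQ _).comp K.mkQ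
  have hχ : Function.Surjective χ :=
    (Submodule.mkQ_surjective _).comp (Submodule.mkQ_surjective _)
  have hrange : LinearMap.range ψ = LinearMap.ker π := by
    ext x
    obtain ⟨x, rfl⟩ := Submodule.mkQ_surjective _ x
    rw [LinearMap.mem_ker, Submodule.mkQ_apply, hπ, Submodule.Quotient.mk_eq_zero,
      mem_span_omegaLT_smul_top]
    constructor
    · rintro ⟨y, hy⟩
      obtain ⟨z, hz⟩ := mem_span_omegaLT_smul_top.1 ((Submodule.Quotient.eq _).1 hy)
      refine ⟨y - PhiLT p (n + 1) • z, ?_⟩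
      rw [smul_sub, ← omegaLT_succ_smul, hz]
      simp
    · rintro ⟨y, rfl⟩
      exact ⟨y, rfl⟩
  have hker : LinearMap.ker ψ = LinearMap.ker χ := by
    ext x
    have h₁ : x ∈ LinearMap.ker ψ ↔ ∃ y, omegaLT p (n + 1) • y = omegaLT p n • x :=
      (Submodule.Quotient.mk_eq_zero _).trans mem_span_omegaLT_smul_top
    have h₂ : x ∈ LinearMap.ker χ ↔
        ∃ y : M ⧸ K, PhiLT p (n + 1) • y = Submodule.Quotient.mk x :=
      Submodule.Quotient.mk_eq_zero _
    rw [h₁, h₂, (Submodule.mkQ_surjective K).exists]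
    refine exists_congr fun y => ?_
    rw [omegaLT_succ_smul, ← sub_eq_zero, ← smul_sub, ← hK', Submodule.mkQ_apply,
      ← Submodule.Quotient.mk_smul, Submodule.Quotient.eq]
  rw [← hrange, ← Nat.card_congr ψ.quotKerEquivRange.toEquiv, hker]
  exact Nat.card_congr (χ.quotKerEquivOfSurjective hχ).toEquiv

theorem natCard_ker_lsmul_quotient {n : ℕ} {K : Submodule ℤ_[p]⟦X⟧ M}
    (hK : LinearMap.ker (LinearMap.lsmul ℤ_[p]⟦X⟧ M (omegaLT p n)) = K)
    (hK' : LinearMap.ker (LinearMap.lsmul ℤ_[p]⟦X⟧ M (omegaLT p (n + 1))) = K) :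
    Nat.card (LinearMap.ker (LinearMap.lsmul ℤ_[p]⟦X⟧ (M ⧸ K) (PhiLT p (n + 1)))) = 1 := by
  have : LinearMap.ker (LinearMap.lsmul ℤ_[p]⟦X⟧ (M ⧸ K) (PhiLT p (n + 1))) = ⊥ := by
    rw [Submodule.eq_bot_iff]
    intro x hx
    obtain ⟨x, rfl⟩ := Submodule.mkQ_surjective _ x
    have h : PhiLT p (n + 1) • x ∈ K := (Submodule.Quotient.mk_eq_zero K).1 hx
    refine (Submodule.Quotient.mk_eq_zero K).2 ?_
    rw [← hK, LinearMap.mem_ker, LinearMap.lsmul_apply] at h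
    rwa [← hK', LinearMap.mem_ker, LinearMap.lsmul_apply, omegaLT_succ_smul]
  rw [this, Nat.card_unique]

theorem exists_ker_omegaLT_eq [Module.Finite ℤ_[p]⟦X⟧ M] :
    ∃ N, ∀ n, N ≤ n → LinearMap.ker (LinearMap.lsmul ℤ_[p]⟦X⟧ M (omegaLT p n)) =
      LinearMap.ker (LinearMap.lsmul ℤ_[p]⟦X⟧ M (omegaLT p N)) := by
  let F : ℕ →o Submodule ℤ_[p]⟦X⟧ M :=
    { toFun := fun n => LinearMap.ker (LinearMap.lsmul ℤ_[p]⟦X⟧ M (omegaLT p n))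
      monotone' := monotone_nat_of_le_succ fun n x hx => by
        rw [LinearMap.mem_ker, LinearMap.lsmul_apply] at hx ⊢
        rw [← PhiLT_succ_mul_omegaLT, mul_smul, hx, smul_zero] }
  obtain ⟨N, hN⟩ := monotone_stabilizes_iff_noetherian.2
    (inferInstance : IsNoetherian ℤ_[p]⟦X⟧ M) F
  exact ⟨N, fun n hn => (hN n hn).symm⟩

theorem exists_natCard_ker_eq [Module.Finite ℤ_[p]⟦X⟧ M]
    (htors : Module.IsTorsion ℤ_[p]⟦X⟧ M) :
    ∃ μ lam N : ℕ, ∀ n, N ≤ n →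
      ∀ π : (M ⧸ (Ideal.span {omegaLT p (n + 1)} • ⊤ : Submodule ℤ_[p]⟦X⟧ M)) →ₗ[ℤ_[p]⟦X⟧]
        (M ⧸ (Ideal.span {omegaLT p n} • ⊤ : Submodule ℤ_[p]⟦X⟧ M)),
      (∀ x : M, π (Submodule.Quotient.mk x) = Submodule.Quotient.mk x) →
      Nat.card (LinearMap.ker π) = p ^ (μ * (p ^ (n + 1)).totient + lam) := by
  obtain ⟨N₀, hN₀⟩ := exists_ker_omegaLT_eq (p := p) (M := M)
  set K := LinearMap.ker (LinearMap.lsmul ℤ_[p]⟦X⟧ M (omegaLT p N₀))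
  have htors' : Module.IsTorsion ℤ_[p]⟦X⟧ (M ⧸ K) := fun x => by
    obtain ⟨x, rfl⟩ := Submodule.mkQ_surjective _ x
    obtain ⟨a, ha⟩ := @htors x
    exact ⟨a, by rw [Submonoid.smul_def] at ha ⊢; rw [← map_smul, ha, map_zero]⟩
  obtain ⟨μ, lam, N, h⟩ := HasIwasawaGrowth.of_isTorsion htors'
  refine ⟨μ, lam, max N₀ N, fun n hn π hπ => ?_⟩
  have hn₀ : N₀ ≤ n := le_of_max_le_left hn
  obtain ⟨j, hj, hcard⟩ := h (n + 1) ((le_of_max_le_right hn).trans n.le_succ)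
  rw [natCard_ker_lsmul_quotient (hN₀ n hn₀) (hN₀ (n + 1) (hn₀.trans n.le_succ)), eq_comm,
    Nat.pow_eq_one] at hj
  obtain rfl : j = 0 := hj.resolve_left (Fact.out : p.Prime).ne_one
  rw [natCard_ker_eq_natCard_quotient_range (hN₀ n hn₀) π hπ, hcard, zero_add]

theorem finrank_quotient_omegaLT_eq_of_natCard_ker [Module ℤ_[p] M]
    [IsScalarTower ℤ_[p] ℤ_[p]⟦X⟧ M] {n k : ℕ}
    (h : ∀ π : (M ⧸ (Ideal.span {omegaLT p (n + 1)} • ⊤ : Submodule ℤ_[p]⟦X⟧ M)) →ₗ[ℤ_[p]⟦X⟧]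
        (M ⧸ (Ideal.span {omegaLT p n} • ⊤ : Submodule ℤ_[p]⟦X⟧ M)),
      (∀ x : M, π (Submodule.Quotient.mk x) = Submodule.Quotient.mk x) →
      Nat.card (LinearMap.ker π) = p ^ k) :
    Module.finrank ℚ_[p] (ℚ_[p] ⊗[ℤ_[p]]
        (M ⧸ (Ideal.span {omegaLT p (n + 1)} • ⊤ : Submodule ℤ_[p]⟦X⟧ M))) =
      Module.finrank ℚ_[p] (ℚ_[p] ⊗[ℤ_[p]]
        (M ⧸ (Ideal.span {omegaLT p n} • ⊤ : Submodule ℤ_[p]⟦X⟧ M))) := by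
  have hle : (Ideal.span {omegaLT p (n + 1)} • ⊤ : Submodule ℤ_[p]⟦X⟧ M) ≤
      Ideal.span {omegaLT p n} • ⊤ := fun x hx => by
    obtain ⟨y, rfl⟩ := mem_span_omegaLT_smul_top.1 hx
    exact mem_span_omegaLT_smul_top.2 ⟨PhiLT p (n + 1) • y, (omegaLT_succ_smul n y).symm⟩
  exact ((Submodule.factor hle).restrictScalars ℤ_[p]).finrank_baseChange_eq_of_natCard_ker
    (Submodule.factor_surjective hle) (h (Submodule.factor hle) fun _ => rfl)
end

end

/-- Kobayashi's Lemma 10.5: if `M` is a finitely generated torsion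
`Λ`-module, then there are `μ, λ` and an index `N` such that for all `n ≥ N`, the natural
surjection `M/ω_n M → M/ω_{n-1} M` (i.e. any `Λ`-linear map commuting with the quotient
projections) has kernel a finite `p`-group of order `p^k`, with
`k + dim_{ℚ_p}((M/ω_{n-1}M) ⊗_{ℤ_p} ℚ_p) = μ·φ(p^n) + λ`. -/
theorem statement0 (p : ℕ) [Fact p.Prime] (hp : Odd p)
    (M : Type*) [AddCommGroup M] [Module (PowerSeries ℤ_[p]) M]
    [Module ℤ_[p] M] [IsScalarTower ℤ_[p] (PowerSeries ℤ_[p]) M]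
    [Module.Finite (PowerSeries ℤ_[p]) M]
    (htors : Module.IsTorsion (PowerSeries ℤ_[p]) M) :
    ∃ μ lam N : ℕ, ∀ n : ℕ, N ≤ n →
      ∀ π : (M ⧸ (Ideal.span {omegaLT p n} • ⊤ : Submodule (PowerSeries ℤ_[p]) M))
              →ₗ[PowerSeries ℤ_[p]]
            (M ⧸ (Ideal.span {omegaLT p (n - 1)} • ⊤ : Submodule (PowerSeries ℤ_[p]) M)),
        (∀ x : M,
            π (Submodule.Quotient.mk x) = Submodule.Quotient.mk x) →
        ∃ k : ℕ, Nat.card (LinearMap.ker π) = p ^ k ∧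
          k + Module.finrank ℚ_[p]
              (ℚ_[p] ⊗[ℤ_[p]]
                (M ⧸ (Ideal.span {omegaLT p (n - 1)} • ⊤ : Submodule (PowerSeries ℤ_[p]) M))) =
            μ * (p ^ n).totient + lam := by
  obtain ⟨μ, lam, N, h⟩ := exists_natCard_ker_eq (p := p) htors
  have hrank (n : ℕ) (hn : N ≤ n) : Module.finrank ℚ_[p] (ℚ_[p] ⊗[ℤ_[p]]
        (M ⧸ (Ideal.span {omegaLT p n} • ⊤ : Submodule (PowerSeries ℤ_[p]) M))) =
      Module.finrank ℚ_[p] (ℚ_[p] ⊗[ℤ_[p]]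
        (M ⧸ (Ideal.span {omegaLT p N} • ⊤ : Submodule (PowerSeries ℤ_[p]) M))) := by
    induction n, hn using Nat.le_induction with
    | base => rfl
    | succ m hm ih => exact (finrank_quotient_omegaLT_eq_of_natCard_ker (h m hm)).trans ih
  refine ⟨μ, lam + Module.finrank ℚ_[p] (ℚ_[p] ⊗[ℤ_[p]]
    (M ⧸ (Ideal.span {omegaLT p N} • ⊤ : Submodule (PowerSeries ℤ_[p]) M))), N + 1,
    fun n hn π hπ => ?_⟩
  obtain ⟨n, rfl⟩ := Nat.exists_eq_succ_of_ne_zero (Nat.ne_of_gt (Nat.zero_lt_of_lt hn))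
  have hn' : N ≤ n := Nat.le_of_succ_le_succ hn
  refine ⟨_, h n hn' π hπ, ?_⟩
  rw [Nat.succ_sub_one, hrank n hn', add_assoc]
end

section
/- Let X be a finitely generated Λ-module, let r ≥ 0 be an integer, I a finite set of non-negative integers, and t_n ≥ 1 integers for n ∈ I, and suppose there is an injective Λ-module homomorphism ι : X → Λ^r ⊕ (⊕_{n∈I} (Λ/Φ_nΛ)^{t_n}) whose cokernel D is finite. Then for every finite set S of non-negative integers with I ⊆ S, writing w = ∏_{n∈S} Φ_n, the p-power torsion submodule (X/wX)[p^∞] is finite of cardinality at most |D|. In particular, taking w = ω_m^+ = ∏_{0≤n≤m, n even} Φ_n (when all elements of I are even and m ≥ max I), the cardinalities |(X/ω_m^+X)[p^∞]| are bounded independently of m, and similarly for ω_m^- = T·∏_{1≤n≤m, n odd} Φ_n when all elements of I are odd or zero. -/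
open PowerSeries in
theorem PowerSeries.C_dvd_iff {R : Type*} [CommRing R] (a : R) (f : PowerSeries R) :
    C a ∣ f ↔ ∀ n, a ∣ coeff n f := by
  constructor
  · rintro ⟨g, rfl⟩ n
    exact ⟨coeff n g, by simp⟩
  · intro h
    choose g hg using h
    exact ⟨mk g, by ext n; simp [hg]⟩

open PowerSeries in
theorem PowerSeries.natCast_prime (p : ℕ) [Fact p.Prime] :
    Prime ((p : ℕ) : PowerSeries ℤ_[p]) := by
  have hmap : ∀ f : PowerSeries ℤ_[p],
      (p : PowerSeries ℤ_[p]) ∣ f ↔ PowerSeries.map (PadicInt.toZMod (p := p)) f = 0 := by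
    intro f
    rw [← map_natCast (C (R := ℤ_[p])), C_dvd_iff, PowerSeries.ext_iff]
    refine forall_congr' fun n => ?_
    rw [coeff_map, map_zero, ← RingHom.mem_ker, PadicInt.ker_toZMod,
      PadicInt.maximalIdeal_eq_span_p, Ideal.mem_span_singleton]
  refine ⟨?_, ?_, ?_⟩
  · rw [← map_natCast (C (R := ℤ_[p])), Ne, map_eq_zero_iff _ C_injective]
    exact PadicInt.prime_p.ne_zero
  · rw [isUnit_iff_dvd_one, hmap]
    simp
  · intro f g
    simp only [hmap, map_mul, mul_eq_zero, imp_self]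

theorem not_natCast_dvd_PhiLT (p : ℕ) [Fact p.Prime] (n : ℕ) :
    ¬ (p : PowerSeries ℤ_[p]) ∣ PhiLT p n := by
  rw [← map_natCast (PowerSeries.C (R := ℤ_[p])), PowerSeries.C_dvd_iff]
  intro h
  have hm : ((Polynomial.cyclotomic (p ^ n) ℤ_[p]).comp (Polynomial.X + 1)).Monic := by
    simpa using (Polynomial.cyclotomic.monic (p ^ n) ℤ_[p]).comp_X_add_C 1
  have h1 := h ((Polynomial.cyclotomic (p ^ n) ℤ_[p]).comp (Polynomial.X + 1)).natDegree
  rw [PhiLT, Polynomial.coeff_coe, hm.coeff_natDegree] at h1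
  exact PadicInt.prime_p.not_dvd_one h1

theorem not_natCast_dvd_prod_PhiLT (p : ℕ) [Fact p.Prime] (S : Finset ℕ) :
    ¬ (p : PowerSeries ℤ_[p]) ∣ ∏ n ∈ S, PhiLT p n := by
  rw [(PowerSeries.natCast_prime p).dvd_finsetProd_iff]
  rintro ⟨n, -, h⟩
  exact not_natCast_dvd_PhiLT p n h

theorem Prime.dvd_of_dvd_pow_mul {R : Type*} [CommRing R] [IsDomain R] {q w f : R}
    (hq : Prime q) (hw : ¬ q ∣ w) {k : ℕ} (h : w ∣ q ^ k * f) : w ∣ f := by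
  obtain ⟨g, hg⟩ := h
  obtain ⟨g', rfl⟩ := hq.pow_dvd_of_dvd_mul_left k hw (Dvd.intro _ hg)
  refine ⟨g', mul_left_cancel₀ (pow_ne_zero k hq.ne_zero) ?_⟩
  rw [hg]
  ring

/-- If `ι : M → E` is injective and `E / wE` has no `p`-power torsion, then the `p`-power torsion
of `M / wM` injects (as a set) into the cokernel of `ι`. -/
theorem card_torsion_quotient_le_card_coker {R M E : Type*} [CommRing R] [AddCommGroup M]
    [Module R M] [AddCommGroup E] [Module R E] (ι : M →ₗ[R] E) (hinj : Function.Injective ι)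
    [Finite (E ⧸ LinearMap.range ι)] (p : ℕ) (w : R)
    (hE : ∀ (k : ℕ) (e e' : E), p ^ k • e = w • e' → ∃ e'', e = w • e'') :
    {x : M ⧸ (Ideal.span {w} • ⊤ : Submodule R M) | ∃ k : ℕ, p ^ k • x = 0}.Finite ∧
    Nat.card {x : M ⧸ (Ideal.span {w} • ⊤ : Submodule R M) | ∃ k : ℕ, p ^ k • x = 0} ≤
      Nat.card (E ⧸ LinearMap.range ι) := by
  have hmem : ∀ x : M, x ∈ (Ideal.span {w} • ⊤ : Submodule R M) ↔ ∃ y, w • y = x := by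
    intro x
    rw [Submodule.ideal_span_singleton_smul, Submodule.mem_smul_pointwise_iff_exists]
    simp
  have key : ∀ x : {x : M ⧸ (Ideal.span {w} • ⊤ : Submodule R M) | ∃ k : ℕ, p ^ k • x = 0},
      ∃ (m : M) (e : E), Submodule.Quotient.mk m = x.1 ∧ ι m = w • e := by
    rintro ⟨x, k, hk⟩
    obtain ⟨m, rfl⟩ := Submodule.Quotient.mk_surjective _ x
    rw [← Submodule.Quotient.mk_smul, Submodule.Quotient.mk_eq_zero, hmem] at hk
    obtain ⟨y, hy⟩ := hk
    obtain ⟨e, he⟩ := hE k (ι m) (ι y) (by rw [← map_nsmul, ← hy, map_smul])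
    exact ⟨m, e, rfl, he⟩
  choose m e hm he using key
  have hf : Function.Injective fun x => (Submodule.Quotient.mk (e x) : E ⧸ LinearMap.range ι) := by
    intro x x' h
    obtain ⟨y, hy⟩ := (Submodule.Quotient.eq _).1 h
    refine Subtype.ext ?_
    rw [← hm, ← hm, Submodule.Quotient.eq, hmem]
    refine ⟨y, hinj ?_⟩
    rw [map_smul, hy, map_sub, he, he, smul_sub]
  exact ⟨Set.finite_coe_iff.1 (Finite.of_injective _ hf), Nat.card_le_card_of_injective _ hf⟩


/-- let `X` be a finitely generated `Λ`-module admitting an injective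
`Λ`-homomorphism `ι : X → Λ^r ⊕ ⊕_{n ∈ I} (Λ/Φ_n)^{t_n}` with finite cokernel `D`. Then for
every finite set `S ⊇ I`, with `w = ∏_{n ∈ S} Φ_n`, the `p`-power torsion part of `X/wX` is
finite of cardinality at most `|D|`. -/
theorem statement3 (p : ℕ) [Fact p.Prime] (hp : Odd p)
    (X : Type*) [AddCommGroup X] [Module (PowerSeries ℤ_[p]) X]
    [Module.Finite (PowerSeries ℤ_[p]) X]
    (r : ℕ) (I : Finset ℕ) (t : ℕ → ℕ) (ht : ∀ n ∈ I, 1 ≤ t n)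
    (ι : X →ₗ[PowerSeries ℤ_[p]]
      ((Fin r → PowerSeries ℤ_[p]) ×
        ((n : I) → Fin (t n) → (PowerSeries ℤ_[p] ⧸ Ideal.span {PhiLT p n}))))
    (hinj : Function.Injective ι)
    (hD : Finite
      (((Fin r → PowerSeries ℤ_[p]) ×
        ((n : I) → Fin (t n) → (PowerSeries ℤ_[p] ⧸ Ideal.span {PhiLT p n}))) ⧸
        LinearMap.range ι)) :
    ∀ S : Finset ℕ, I ⊆ S →
      ({x : X ⧸ (Ideal.span {∏ n ∈ S, PhiLT p n} • ⊤ : Submodule (PowerSeries ℤ_[p]) X) |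
          ∃ k : ℕ, p ^ k • x = 0}).Finite ∧
      Nat.card
        {x : X ⧸ (Ideal.span {∏ n ∈ S, PhiLT p n} • ⊤ : Submodule (PowerSeries ℤ_[p]) X) |
          ∃ k : ℕ, p ^ k • x = 0} ≤
      Nat.card
        (((Fin r → PowerSeries ℤ_[p]) ×
          ((n : I) → Fin (t n) → (PowerSeries ℤ_[p] ⧸ Ideal.span {PhiLT p n}))) ⧸
          LinearMap.range ι) := by
  intro S hIS
  have hp' := PowerSeries.natCast_prime p
  refine card_torsion_quotient_le_card_coker ι hinj p _ ?_
  rintro k ⟨a, b⟩ ⟨a', b'⟩ h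
  obtain ⟨h₁, h₂⟩ := Prod.ext_iff.1 h
  have ha : ∀ i, ∏ n ∈ S, PhiLT p n ∣ a i := fun i =>
    hp'.dvd_of_dvd_pow_mul (not_natCast_dvd_prod_PhiLT p S) (k := k)
      ⟨a' i, by simpa using congrFun h₁ i⟩
  choose c hc using ha
  refine ⟨(c, 0), Prod.ext (funext hc) (funext fun n => funext fun j => ?_)⟩
  have hn := congrFun (congrFun h₂ n) j
  obtain ⟨x, hx⟩ := Ideal.Quotient.mk_surjective (b n j)
  obtain ⟨y, hy⟩ := Ideal.Quotient.mk_surjective (b' n j)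
  simp only [Prod.smul_snd, Pi.smul_apply, smul_zero, Pi.zero_apply] at hn ⊢
  have hdvd : PhiLT p n ∣ ∏ n ∈ S, PhiLT p n := Finset.dvd_prod_of_mem _ (hIS n.2)
  have hzero : (∏ n ∈ S, PhiLT p n) • b' n j = 0 := by
    rw [← hy]
    exact (Ideal.Quotient.eq_zero_iff_dvd _ _).2 (hdvd.mul_right y)
  rw [hzero, ← hx, nsmul_eq_mul, ← map_natCast (Ideal.Quotient.mk _), ← map_mul,
    Ideal.Quotient.eq_zero_iff_dvd, Nat.cast_pow] at hn
  rw [← hx]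
  exact (Ideal.Quotient.eq_zero_iff_dvd _ _).2
    (hp'.dvd_of_dvd_pow_mul (not_natCast_dvd_PhiLT p n) hn)
end

section
/- Let n ≥ 0 and let W be a Λ-module that is torsion-free as a ℤ_p-module. Then every Λ-module homomorphism Λ/Φ_nΛ → W is either the zero map or injective. -/
open Polynomial

theorem cyclotomic_comp_X_add_one_map_intCast (R : Type*) [CommRing R] (m : ℕ) :
    ((cyclotomic m ℤ).comp (X + 1)).map (Int.castRingHom R) =
      (cyclotomic m R).comp (X + 1) := by
  simp [map_comp]

theorem monic_cyclotomic_comp_X_add_one (R : Type*) [CommRing R] [Nontrivial R] (m : ℕ) :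
    ((cyclotomic m R).comp (X + 1)).Monic :=
  (cyclotomic.monic m R).comp_X_add_C 1

theorem isDistinguishedAt_cyclotomic_prime_pow_comp_X_add_one (p : ℕ) [Fact p.Prime] (n : ℕ) :
    ((cyclotomic (p ^ n) ℤ_[p]).comp (X + 1)).IsDistinguishedAt
      (IsLocalRing.maximalIdeal ℤ_[p]) := by
  refine ⟨?_, monic_cyclotomic_comp_X_add_one _ _⟩
  cases n with
  | zero =>
    refine ⟨fun {i} hi => ?_⟩
    have : (cyclotomic (p ^ 0) ℤ_[p]).comp (X + 1) = X := by simp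
    rw [this] at hi ⊢
    rw [natDegree_X, Nat.lt_one_iff] at hi
    simp [hi]
  | succ n =>
    have h := (cyclotomic_prime_pow_comp_X_add_one_isEisensteinAt p n).isWeaklyEisensteinAt.map
      (Int.castRingHom ℤ_[p])
    rw [cyclotomic_comp_X_add_one_map_intCast, Ideal.submodule_span_eq, Ideal.map_span] at h
    simpa [PadicInt.maximalIdeal_eq_span_p] using h

theorem coeff_zero_cyclotomic_prime_pow_comp_X_add_one (R : Type*) [CommRing R] (p : ℕ)
    [Fact p.Prime] (n : ℕ) :
    ((cyclotomic (p ^ (n + 1)) R).comp (X + 1)).coeff 0 = p := by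
  rw [coeff_zero_eq_eval_zero, eval_comp]
  simp

theorem prime_cyclotomic_prime_pow_comp_X_add_one (p : ℕ) [Fact p.Prime] (n : ℕ) :
    Prime ((cyclotomic (p ^ n) ℤ_[p]).comp (X + 1)) := by
  cases n with
  | zero => simpa using prime_X
  | succ n =>
    have hmonic := monic_cyclotomic_comp_X_add_one ℤ_[p] (p ^ (n + 1))
    have hE : ((cyclotomic (p ^ (n + 1)) ℤ_[p]).comp (X + 1)).IsEisensteinAt
        (IsLocalRing.maximalIdeal ℤ_[p]) := by
      refine hmonic.isEisensteinAt_of_mem_of_notMem (Ideal.IsPrime.ne_top inferInstance)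
        (isDistinguishedAt_cyclotomic_prime_pow_comp_X_add_one p (n + 1)).mem ?_
      rw [coeff_zero_cyclotomic_prime_pow_comp_X_add_one, PadicInt.maximalIdeal_eq_span_p,
        Ideal.span_singleton_pow, Ideal.mem_span_singleton]
      nth_rewrite 2 [← pow_one (p : ℤ_[p])]
      rw [pow_dvd_pow_iff PadicInt.prime_p.ne_zero PadicInt.prime_p.not_isUnit]
      norm_num
    refine (hE.irreducible inferInstance hmonic.isPrimitive ?_).prime
    rw [show (X + 1 : ℤ_[p][X]) = X + C 1 by simp, natDegree_comp, natDegree_X_add_C, mul_one,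
      natDegree_cyclotomic]
    exact Nat.totient_pos.mpr (pow_pos (Fact.out : p.Prime).pos _)

/-- A nonzero linear map from a cyclic module `B ⧸ J` is injective if the ring `B ⧸ J` is a domain
integral over `A` and the target has no `A`-torsion. -/
theorem LinearMap.eq_zero_or_injective_of_quotient_isIntegral {A B W : Type*} [CommRing A]
    [Nontrivial A] [CommRing B] [Algebra A B] (J : Ideal B) [IsDomain (B ⧸ J)]
    [Algebra.IsIntegral A (B ⧸ J)] [AddCommGroup W] [Module B W] [Module A W]
    [IsScalarTower A B W] [NoZeroSMulDivisors A W] (f : (B ⧸ J) →ₗ[B] W) :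
    f = 0 ∨ Function.Injective f := by
  rw [or_iff_not_imp_right, injective_iff_map_eq_zero]
  intro h
  push Not at h
  obtain ⟨x, hfx, hx⟩ := h
  obtain ⟨d, hd, hd0⟩ := Submodule.exists_mem_ne_zero_of_ne_bot
    (Ideal.comap_ne_bot_of_integral_mem (R := A) hx (Ideal.mem_span_singleton_self x)
      (Algebra.IsIntegral.isIntegral x))
  obtain ⟨y, hy⟩ := Ideal.mem_span_singleton'.1 (Ideal.mem_comap.1 hd)
  obtain ⟨b, rfl⟩ := Ideal.Quotient.mk_surjective y
  have hd1 : d • f 1 = 0 := by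
    rw [← algebraMap_smul B d (f 1), ← map_smul, Algebra.smul_def, mul_one,
      Ideal.Quotient.algebraMap_eq, Ideal.Quotient.mk_algebraMap, ← hy,
      ← Ideal.Quotient.algebraMap_eq, ← Algebra.smul_def, map_smul, hfx, smul_zero]
  have h1 : f 1 = 0 :=
    (NoZeroSMulDivisors.eq_zero_or_eq_zero_of_smul_eq_zero hd1).resolve_left hd0
  ext
  simpa using h1

/-- if `W` is a `Λ`-module which is torsion-free as a `ℤ_p`-module, then any
`Λ`-module homomorphism `Λ/Φ_nΛ → W` is either zero or injective. -/
theorem statement6 (p : ℕ) [Fact p.Prime] (hp : Odd p) (n : ℕ)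
    (W : Type*) [AddCommGroup W] [Module (PowerSeries ℤ_[p]) W]
    [Module ℤ_[p] W] [IsScalarTower ℤ_[p] (PowerSeries ℤ_[p]) W]
    [NoZeroSMulDivisors ℤ_[p] W]
    (f : (PowerSeries ℤ_[p] ⧸ Ideal.span {PhiLT p n}) →ₗ[PowerSeries ℤ_[p]] W) :
    f = 0 ∨ Function.Injective f := by
  let e : (ℤ_[p][X] ⧸ Ideal.span {(cyclotomic (p ^ n) ℤ_[p]).comp (X + 1)}) ≃ₐ[ℤ_[p]]
      (PowerSeries ℤ_[p] ⧸ Ideal.span {PhiLT p n}) :=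
    (isDistinguishedAt_cyclotomic_prime_pow_comp_X_add_one p n).algEquivQuotient
  have hprime := prime_cyclotomic_prime_pow_comp_X_add_one p n
  have := (Ideal.span_singleton_prime hprime.ne_zero).2 hprime
  have : IsDomain (PowerSeries ℤ_[p] ⧸ Ideal.span {PhiLT p n}) :=
    e.symm.toMulEquiv.isDomain _
  have : Module.Finite ℤ_[p] (ℤ_[p][X] ⧸ Ideal.span {(cyclotomic (p ^ n) ℤ_[p]).comp (X + 1)}) :=
    (monic_cyclotomic_comp_X_add_one ℤ_[p] (p ^ n)).finite_quotient
  have : Module.Finite ℤ_[p] (PowerSeries ℤ_[p] ⧸ Ideal.span {PhiLT p n}) :=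
    Module.Finite.equiv e.toLinearEquiv
  exact LinearMap.eq_zero_or_injective_of_quotient_isIntegral (A := ℤ_[p]) _ f
end
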